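/- Let p be an odd prime, let 0 < k < j ≤ i ≤ e with e = i + j − k, and let G be the group with presentation ⟨a, b ∣ a^{p^e} = [b,a]^{p^j} = [b,a,a] = [b,a,b] = 1, b^{p^i} = [b,a]^{p^k}⟩. Then for every pair x, y ∈ G with ⟨x, y⟩ = G, there do not exist an automorphism θ of G and an element g ∈ G such that θ(x) = g⁻¹x⁻¹g and θ(y) = g⁻¹y⁻¹g. -/

import Mathlib

/-- The commutator `[a,b] = a⁻¹ b⁻¹ a b`. -/
def commG {G : Type*} [Group G] (a b : G) : G := a⁻¹ * b⁻¹ * a * b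
/-- The relations of the presentation
`⟨a, b ∣ a^{p^e} = [b,a]^{p^j} = [b,a,a] = [b,a,b] = 1, b^{p^i} = [b,a]^{p^k}⟩`,
where `a` and `b` are the images of `0` and `1` respectively. -/
def class2Rels (p e i j k : ℕ) : Set (FreeGroup (Fin 2)) :=
  { FreeGroup.of 0 ^ p ^ e,
    commG (FreeGroup.of 1) (FreeGroup.of 0) ^ p ^ j,
    commG (commG (FreeGroup.of 1) (FreeGroup.of 0)) (FreeGroup.of 0),
    commG (commG (FreeGroup.of 1) (FreeGroup.of 0)) (FreeGroup.of 1),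
    FreeGroup.of 1 ^ p ^ i * (commG (FreeGroup.of 1) (FreeGroup.of 0) ^ p ^ k)⁻¹ }

lemma map_commG {G H : Type*} [Group G] [Group H] (φ : G →* H) (u v : G) :
    φ (commG u v) = commG (φ u) (φ v) := by
  simp [commG]

lemma commG_eq_one_iff {G : Type*} [Group G] {u v : G} : commG u v = 1 ↔ Commute u v := by
  have h : commG u v = (v * u)⁻¹ * (u * v) := by unfold commG; group
  rw [h, inv_mul_eq_one]
  exact eq_comm

/-- An element commuting with a generating set is central. -/
lemma mem_center_of_closure_eq_top {G : Type*} [Group G] {S : Set G}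
    (hS : Subgroup.closure S = ⊤) {z : G} (hz : ∀ s ∈ S, Commute s z) :
    z ∈ Subgroup.center G := by
  rw [← Subgroup.centralizer_univ, ← Subgroup.coe_top, ← hS, Subgroup.centralizer_closure]
  exact Subgroup.mem_centralizer_iff.mpr hz

/-- A homomorphism to a commutative quotient that inverts a generating set inverts everything. -/
lemma map_mul_map_eq_one_of_closure_eq_top {G Q : Type*} [Group G] [Group Q]
    (hQ : ∀ u v : Q, Commute u v) {S : Set G} (hS : Subgroup.closure S = ⊤) (f g : G →* Q)
    (hfg : ∀ s ∈ S, f s * g s = 1) (h : G) : f h * g h = 1 := by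
  have hh : h ∈ Subgroup.closure S := hS ▸ Subgroup.mem_top h
  induction hh using Subgroup.closure_induction with
  | mem s hs => exact hfg s hs
  | one => simp
  | mul u v _ _ hu hv =>
    rw [map_mul, map_mul, mul_assoc, ← mul_assoc (f v), (hQ (f v) (g u)).eq, mul_assoc, hv,
      mul_one, hu]
  | inv u _ hu =>
    rw [map_inv, map_inv, (hQ _ _).eq, ← mul_inv_rev, hu, inv_one]

/-- If `[b,a]` commutes with the generators `a, b`, then a homomorphism inverting a generating set
up to conjugation inverts every element modulo `⟨[b,a]⟩`. -/
lemma map_mul_self_mem_zpowers_commG {G : Type*} [Group G] {a b : G}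
    (hab : Subgroup.closure {a, b} = ⊤) (hc : commG b a ∈ Subgroup.center G)
    {S : Set G} (hS : Subgroup.closure S = ⊤) (θ : G →* G) (g : G)
    (hθ : ∀ s ∈ S, θ s = g⁻¹ * s⁻¹ * g) (h : G) :
    θ h * h ∈ Subgroup.zpowers (commG b a) := by
  have hle : Subgroup.zpowers (commG b a) ≤ Subgroup.center G := by
    rwa [Subgroup.zpowers_le]
  have : (Subgroup.zpowers (commG b a)).Normal := ⟨fun n hn g => by
    rwa [Subgroup.mem_center_iff.mp (hle hn) g, mul_inv_cancel_right]⟩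
  let π := QuotientGroup.mk' (Subgroup.zpowers (commG b a))
  have hπ : Subgroup.closure (π '' {a, b}) = ⊤ := by
    rw [← MonoidHom.map_closure, hab, ← MonoidHom.range_eq_map, MonoidHom.range_eq_top]
    exact QuotientGroup.mk'_surjective _
  have hba : Commute (π b) (π a) := by
    have h1 : π (commG b a) = 1 :=
      (QuotientGroup.eq_one_iff _).mpr (Subgroup.mem_zpowers _)
    rwa [map_commG, commG_eq_one_iff] at h1
  have hcen : ∀ s ∈ π '' {a, b}, s ∈ Subgroup.center _ := by
    rintro _ ⟨s, hs, rfl⟩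
    refine mem_center_of_closure_eq_top hπ ?_
    rintro _ ⟨t, ht, rfl⟩
    rcases hs with rfl | rfl <;> rcases ht with rfl | rfl
    exacts [Commute.refl _, hba, hba.symm, Commute.refl _]
  have hcomm : ∀ u v : G ⧸ Subgroup.zpowers (commG b a), Commute u v := by
    intro u v
    have hv : v ∈ Subgroup.center _ :=
      (Subgroup.closure_le _).mpr hcen (hπ ▸ Subgroup.mem_top v)
    exact Subgroup.mem_center_iff.mp hv u
  have key := map_mul_map_eq_one_of_closure_eq_top hcomm hS (π.comp θ) π (fun s hs => by
    rw [MonoidHom.comp_apply, hθ s hs, map_mul, map_mul, (hcomm (π g⁻¹) _).eq, mul_assoc (π s⁻¹),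
      ← map_mul, inv_mul_cancel, map_one, mul_one, ← map_mul, inv_mul_cancel, map_one]) h
  rw [MonoidHom.comp_apply, ← map_mul] at key
  exact (QuotientGroup.eq_one_iff _).mp key

/-- `[b,a]` is unchanged when `b` and `a` are inverted up to central factors,
if `[b,a]` itself is central. -/
lemma commG_inv_mul_inv_mul {G : Type*} [Group G] {a b z w : G}
    (hc : commG b a ∈ Subgroup.center G) (hz : z ∈ Subgroup.center G)
    (hw : w ∈ Subgroup.center G) : commG (z * b⁻¹) (w * a⁻¹) = commG b a := by
  have hz' := Subgroup.mem_center_iff.mp hz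
  have hw' := Subgroup.mem_center_iff.mp hw
  have hc' := Subgroup.mem_center_iff.mp hc
  calc commG (z * b⁻¹) (w * a⁻¹)
      = b * (z⁻¹ * a * (w⁻¹ * z)) * b⁻¹ * w * a⁻¹ := by unfold commG; group
    _ = b * (z⁻¹ * a * (z * w⁻¹)) * b⁻¹ * w * a⁻¹ := by rw [hz' w⁻¹]
    _ = b * (z⁻¹ * (a * z) * w⁻¹) * b⁻¹ * w * a⁻¹ := by group
    _ = b * (z⁻¹ * (z * a) * w⁻¹) * b⁻¹ * w * a⁻¹ := by rw [hz' a]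
    _ = b * a * w⁻¹ * (b⁻¹ * w) * a⁻¹ := by group
    _ = b * a * w⁻¹ * (w * b⁻¹) * a⁻¹ := by rw [hw' b⁻¹]
    _ = b * a * commG b a * (b * a)⁻¹ := by unfold commG; group
    _ = commG b a := by rw [hc' (b * a)]; group

/-- The shear `(s, t) ↦ (s, t - s)`. -/
def shearPerm (R : Type*) [CommRing R] : Equiv.Perm (R × R) where
  toFun v := (v.1, v.2 - v.1)
  invFun v := (v.1, v.2 + v.1)
  left_inv v := by simp
  right_inv v := by simp

lemma shearPerm_pow_apply {R : Type*} [CommRing R] (n : ℕ) (v : R × R) :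
    (shearPerm R ^ n) v = (v.1, v.2 - n * v.1) := by
  induction n with
  | zero => simp
  | succ n ih =>
    rw [pow_succ', Equiv.Perm.mul_apply, ih]
    simp only [shearPerm, Equiv.coe_fn_mk, Prod.mk.injEq, true_and]
    push_cast
    ring

lemma commG_addRight_shearPerm {R : Type*} [CommRing R] (q : R) :
    commG (Equiv.addRight (q, (1 : R))) (shearPerm R) = Equiv.addRight ((0 : R), q) := by
  ext v
  · simp [commG, shearPerm, Equiv.Perm.inv_def]
  · simp [commG, shearPerm, Equiv.Perm.inv_def]
    ring

/-- The commutator `[b,a]` has order larger than `p ^ k` in the presented group. -/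
lemma commG_of_pow_ne_one {p e i j k : ℕ} (hp : p.Prime) (hkj : k < j) (hji : j ≤ i)
    (heijk : e + k = i + j) :
    (commG (PresentedGroup.of (rels := class2Rels p e i j k) 1)
      (PresentedGroup.of 0)) ^ p ^ k ≠ 1 := by
  let R := ZMod (p ^ e)
  have hzero : ∀ n, e ≤ n → (p : R) ^ n = 0 := by
    intro n hn
    have h := (ZMod.natCast_eq_zero_iff (p ^ n) (p ^ e)).mpr (pow_dvd_pow p hn)
    exact_mod_cast h
  let q : R := (p : R) ^ (i - k)
  let f : Fin 2 → Equiv.Perm (R × R) := ![shearPerm R, Equiv.addRight (q, (1 : R))]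
  have hcomm : commG (f 1) (f 0) = Equiv.addRight ((0 : R), q) := commG_addRight_shearPerm q
  have hki : (p : R) ^ k * q = (p : R) ^ i := by
    rw [← pow_add]; congr 1; omega
  have hrels : ∀ r ∈ class2Rels p e i j k, FreeGroup.lift f r = 1 := by
    rintro r (rfl | rfl | rfl | rfl | rfl)
    · rw [map_pow, FreeGroup.lift_apply_of]
      ext v <;> simp [f, shearPerm_pow_apply]
    · rw [map_pow, map_commG, FreeGroup.lift_apply_of, FreeGroup.lift_apply_of, hcomm]
      have : (p : R) ^ j * q = 0 := by
        rw [← pow_add]; exact hzero _ (by omega)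
      ext v <;> simp [this]
    · rw [map_commG, map_commG, FreeGroup.lift_apply_of, FreeGroup.lift_apply_of, hcomm]
      refine commG_eq_one_iff.mpr ?_
      show _ * _ = _ * _
      ext v <;> simp [f, shearPerm]; ring
    · rw [map_commG, map_commG, FreeGroup.lift_apply_of, FreeGroup.lift_apply_of, hcomm]
      refine commG_eq_one_iff.mpr ?_
      show _ * _ = _ * _
      ext v <;> simp [f]; ring
    · rw [map_mul, map_inv, map_pow, map_pow, map_commG, FreeGroup.lift_apply_of,
        FreeGroup.lift_apply_of, hcomm, mul_inv_eq_one]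
      have : (p : R) ^ i * q = 0 := by
        rw [← pow_add]; exact hzero _ (by omega)
      ext v <;> simp [f, this, hki]
  intro h
  have h' := congrArg (PresentedGroup.toGroup hrels) h
  rw [map_pow, map_commG, PresentedGroup.toGroup.of, PresentedGroup.toGroup.of, hcomm, map_one] at h'
  have h'' : (p : R) ^ i = 0 := by
    simpa [hki] using congrArg (fun σ : Equiv.Perm (R × R) => (σ 0).2) h'
  have hdvd : p ^ e ∣ p ^ i := by
    rw [← ZMod.natCast_eq_zero_iff]; exact_mod_cast h''
  have := (Nat.pow_dvd_pow_iff_le_right hp.one_lt).mp hdvd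
  omega

/-- Let `p` be an odd prime, `0 < k < j ≤ i ≤ e` with `e = i + j - k`,
and let `G = ⟨a, b ∣ a^{p^e} = [b,a]^{p^j} = [b,a,a] = [b,a,b] = 1, b^{p^i} = [b,a]^{p^k}⟩`.
For every generating pair `x, y` of `G` there are no automorphism `θ` and element `g`
with `θ(x) = (x⁻¹)^g` and `θ(y) = (y⁻¹)^g`. -/
theorem stmt9 (p e i j k : ℕ) (hp : p.Prime) (hodd : Odd p)
    (hk : 0 < k) (hkj : k < j) (hji : j ≤ i) (hie : i ≤ e) (heijk : e + k = i + j) :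
    ∀ x y : PresentedGroup (class2Rels p e i j k),
      Subgroup.closure {x, y} = ⊤ →
      ¬ ∃ (θ : PresentedGroup (class2Rels p e i j k) ≃*
              PresentedGroup (class2Rels p e i j k))
          (g : PresentedGroup (class2Rels p e i j k)),
          θ x = g⁻¹ * x⁻¹ * g ∧ θ y = g⁻¹ * y⁻¹ * g := by
  rintro x y hxy ⟨θ, g, hx, hy⟩
  let a : PresentedGroup (class2Rels p e i j k) := PresentedGroup.of 0
  let b : PresentedGroup (class2Rels p e i j k) := PresentedGroup.of 1
  let π := PresentedGroup.mk (class2Rels p e i j k)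
  have hrel : ∀ r ∈ class2Rels p e i j k, π r = 1 := fun r hr =>
    PresentedGroup.one_of_mem hr
  have hcj : commG b a ^ p ^ j = 1 := by
    have := hrel _ (Or.inr (Or.inl rfl))
    rwa [map_pow, map_commG] at this
  have hca : commG (commG b a) a = 1 := by
    have := hrel _ (Or.inr (Or.inr (Or.inl rfl)))
    rwa [map_commG, map_commG] at this
  have hcb : commG (commG b a) b = 1 := by
    have := hrel _ (Or.inr (Or.inr (Or.inr (Or.inl rfl))))
    rwa [map_commG, map_commG] at this
  have hbi : b ^ p ^ i = commG b a ^ p ^ k := by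
    have := hrel _ (Or.inr (Or.inr (Or.inr (Or.inr rfl))))
    rwa [map_mul, map_inv, map_pow, map_pow, map_commG, mul_inv_eq_one] at this
  have hab : Subgroup.closure {a, b} = ⊤ := by
    rw [← PresentedGroup.closure_range_of]
    congr 1
    ext u
    simp [a, b, eq_comm]
  have hc : commG b a ∈ Subgroup.center _ := by
    refine mem_center_of_closure_eq_top hab ?_
    rintro s (rfl | rfl)
    exacts [(commG_eq_one_iff.mp hca).symm, (commG_eq_one_iff.mp hcb).symm]
  have hθ := map_mul_self_mem_zpowers_commG hab hc hxy θ.toMonoidHom g (by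
    rintro s (rfl | rfl)
    exacts [hx, hy])
  obtain ⟨m, hm : _ = θ b * b⟩ := hθ b
  obtain ⟨n, hn : _ = θ a * a⟩ := hθ a
  have hθb := eq_mul_inv_of_mul_eq hm.symm
  have hθa := eq_mul_inv_of_mul_eq hn.symm
  have hz := Subgroup.zpow_mem _ hc m
  have hθc : θ (commG b a) = commG b a := by
    have := map_commG θ.toMonoidHom b a
    simp only [MulEquiv.toMonoidHom_eq_coe, MonoidHom.coe_coe] at this
    rw [this, hθb, hθa]
    exact commG_inv_mul_inv_mul hc hz (Subgroup.zpow_mem _ hc n)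
  have hci : commG b a ^ p ^ i = 1 :=
    orderOf_dvd_iff_pow_eq_one.mp ((orderOf_dvd_of_pow_eq_one hcj).trans (pow_dvd_pow p hji))
  have hinv : (commG b a ^ p ^ k)⁻¹ = commG b a ^ p ^ k := by
    have h1 := congrArg θ hbi
    have hcomm : Commute (commG b a ^ m) b⁻¹ := (Subgroup.mem_center_iff.mp hz b⁻¹).symm
    rw [map_pow, map_pow, hθc, hθb, hcomm.mul_pow, ← zpow_natCast, ← zpow_mul, mul_comm m,
      zpow_mul, zpow_natCast, hci, one_zpow, one_mul, inv_pow, hbi] at h1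
    exact h1
  have hsq : (commG b a ^ p ^ k) ^ 2 = 1 := by
    rw [pow_two, ← mul_inv_cancel (commG b a ^ p ^ k), hinv]
  have hpj : (commG b a ^ p ^ k) ^ p ^ j = 1 := by
    rw [← pow_mul, mul_comm, pow_mul, hcj, one_pow]
  have hone : commG b a ^ p ^ k = 1 := by
    rw [← orderOf_eq_one_iff]
    exact Nat.eq_one_of_dvd_coprimes (Nat.coprime_two_left.mpr hodd.pow)
      (orderOf_dvd_of_pow_eq_one hsq) (orderOf_dvd_of_pow_eq_one hpj)
  exact commG_of_pow_ne_one hp hkj hji heijk hone
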